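/- Maximum principle, degenerate case k>1, supercritical gradient power (Theorem 2.6(b)): Suppose H satisfies Conditions A–C with k₁ > 0 (so k > 1 and γ > 2) and Λ^sup < ∞. Let h : ℝⁿ → ℝ be continuous with sup_{ℝⁿ} h < ∞, let m ∈ ℝ, let Z : [m,∞) → [0,∞) be continuous and non-increasing, let χ : (0,T) → ℝ be bounded and continuous, and let σ > γ/2. Let u be upper semicontinuous on ℝⁿ × [0,T) with inf u > m, a viscosity subsolution of H(Du, D²u + Z(u)Du⊗Du) + χ(t)|Du|^σ − u_t = 0 in ℝⁿ_T, with u(x,0) ≤ h(x) for all x ∈ ℝⁿ. If sup_{B^R_T} u = o(R^{σ*}) as R → ∞, then u(x,t) ≤ sup_{ℝⁿ} h for all (x,t) ∈ ℝⁿ_T. -/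

import Mathlib

open Set MeasureTheory

noncomputable section

/-- The rank-one matrix `q ⊗ q`. -/
def outerProd {n : ℕ} (q : EuclideanSpace ℝ (Fin n)) : Matrix (Fin n) (Fin n) ℝ :=
  Matrix.of fun i j => q i * q j

/-- The Loewner partial order on real matrices: `X ≤ Y` iff `Y - X` is positive semidefinite. -/
def LoewnerLE {n : ℕ} (X Y : Matrix (Fin n) (Fin n) ℝ) : Prop := (Y - X).PosSemidef

/-- Conditions A (monotonicity), B (homogeneity) and C (growth at infinity) on `H`. -/
structure ConditionsABC (n : ℕ)
    (H : EuclideanSpace ℝ (Fin n) → Matrix (Fin n) (Fin n) ℝ → ℝ) (k₁ : ℝ) : Prop where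
  continuous : Continuous fun p : EuclideanSpace ℝ (Fin n) × Matrix (Fin n) (Fin n) ℝ => H p.1 p.2
  monotone : ∀ q X Y, X.IsSymm → Y.IsSymm → LoewnerLE X Y → H q X ≤ H q Y
  zero_eq : ∀ q, H q 0 = 0
  k₁_nonneg : 0 ≤ k₁
  hom_q : ∀ (θ : ℝ) (q : EuclideanSpace ℝ (Fin n)) (X), H (θ • q) X = |θ| ^ k₁ * H q X
  hom_X : ∀ (θ : ℝ), 0 < θ → ∀ q X, H q (θ • X) = θ * H q X
  max_neg : ∀ e : EuclideanSpace ℝ (Fin n), ‖e‖ = 1 → H e (-1) < 0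
  min_pos : ∀ e : EuclideanSpace ℝ (Fin n), ‖e‖ = 1 → 0 < H e 1

/-- `Λ^sup = sup_λ max_{|e|=1} H(e, λ e⊗e + I) < ∞`. -/
def LambdaSupFinite (n : ℕ)
    (H : EuclideanSpace ℝ (Fin n) → Matrix (Fin n) (Fin n) ℝ → ℝ) : Prop :=
  ∃ C : ℝ, ∀ (lam : ℝ) (e : EuclideanSpace ℝ (Fin n)), ‖e‖ = 1 →
    H e (lam • outerProd e + 1) ≤ C

/-- `Λ^inf = inf_λ min_{|e|=1} H(e, λ e⊗e - I) > -∞`. -/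
def LambdaInfFinite (n : ℕ)
    (H : EuclideanSpace ℝ (Fin n) → Matrix (Fin n) (Fin n) ℝ → ℝ) : Prop :=
  ∃ C : ℝ, ∀ (lam : ℝ) (e : EuclideanSpace ℝ (Fin n)), ‖e‖ = 1 →
    C ≤ H e (lam • outerProd e - 1)

/-- The spatial gradient of `ψ` at `x`, as a vector in `ℝⁿ`. -/
def spaceGrad {n : ℕ} (ψ : EuclideanSpace ℝ (Fin n) → ℝ) (x : EuclideanSpace ℝ (Fin n)) :
    EuclideanSpace ℝ (Fin n) :=
  (EuclideanSpace.equiv (Fin n) ℝ).symm fun i => fderiv ℝ ψ x (EuclideanSpace.single i 1)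

/-- The spatial Hessian matrix of `ψ` at `x`. -/
def spaceHess {n : ℕ} (ψ : EuclideanSpace ℝ (Fin n) → ℝ) (x : EuclideanSpace ℝ (Fin n)) :
    Matrix (Fin n) (Fin n) ℝ :=
  Matrix.of fun i j =>
    fderiv ℝ (fun y => fderiv ℝ ψ y (EuclideanSpace.single j 1)) x (EuclideanSpace.single i 1)

/-- Viscosity subsolution of `F(t, u, Du, D²u, u_t) = 0` on `Ω ⊆ ℝⁿ × ℝ`, tested against
functions `φ(x,t)` that are C² in `x` and C¹ in `t`: whenever `u - φ` has a local maximum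
at `(x₀,t₀) ∈ Ω`, one has `F(t₀, u(x₀,t₀), Dφ, D²φ, φ_t) ≥ 0` there. -/
def ParabolicSubsolution {n : ℕ}
    (F : ℝ → ℝ → EuclideanSpace ℝ (Fin n) → Matrix (Fin n) (Fin n) ℝ → ℝ → ℝ)
    (Ω : Set (EuclideanSpace ℝ (Fin n) × ℝ)) (u : EuclideanSpace ℝ (Fin n) × ℝ → ℝ) : Prop :=
  ∀ φ : EuclideanSpace ℝ (Fin n) → ℝ → ℝ,
    (∀ t, ContDiff ℝ 2 fun x => φ x t) →
    (∀ x, ContDiff ℝ 1 fun t => φ x t) →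
    ∀ x₀ t₀, (x₀, t₀) ∈ Ω →
      IsLocalMaxOn (fun p => u p - φ p.1 p.2) Ω (x₀, t₀) →
      0 ≤ F t₀ (u (x₀, t₀)) (spaceGrad (fun x => φ x t₀) x₀) (spaceHess (fun x => φ x t₀) x₀)
          (deriv (φ x₀) t₀)

/-- Viscosity supersolution of `F(t, u, Du, D²u, u_t) = 0` on `Ω ⊆ ℝⁿ × ℝ`. -/
def ParabolicSupersolution {n : ℕ}
    (F : ℝ → ℝ → EuclideanSpace ℝ (Fin n) → Matrix (Fin n) (Fin n) ℝ → ℝ → ℝ)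
    (Ω : Set (EuclideanSpace ℝ (Fin n) × ℝ)) (u : EuclideanSpace ℝ (Fin n) × ℝ → ℝ) : Prop :=
  ∀ φ : EuclideanSpace ℝ (Fin n) → ℝ → ℝ,
    (∀ t, ContDiff ℝ 2 fun x => φ x t) →
    (∀ x, ContDiff ℝ 1 fun t => φ x t) →
    ∀ x₀ t₀, (x₀, t₀) ∈ Ω →
      IsLocalMinOn (fun p => u p - φ p.1 p.2) Ω (x₀, t₀) →
      F t₀ (u (x₀, t₀)) (spaceGrad (fun x => φ x t₀) x₀) (spaceHess (fun x => φ x t₀) x₀)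
          (deriv (φ x₀) t₀) ≤ 0

open Filter Topology

/-- Weight `(1+|x-z|²)^p`. -/
def wt {n : ℕ} (z : EuclideanSpace ℝ (Fin n)) (p : ℝ) (x : EuclideanSpace ℝ (Fin n)) : ℝ :=
  (1 + ‖x - z‖ ^ 2) ^ p

lemma base_pos {n : ℕ} (z x : EuclideanSpace ℝ (Fin n)) : 0 < 1 + ‖x - z‖ ^ 2 := by positivity

lemma wt_contDiff {n : ℕ} (z : EuclideanSpace ℝ (Fin n)) (p : ℝ) : ContDiff ℝ 2 (wt z p) := by
  unfold wt
  refine ContDiff.rpow_const_of_ne ?_ (fun x => (base_pos z x).ne')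
  exact contDiff_const.add ((contDiff_id.sub contDiff_const).norm_sq ℝ)

lemma wt_hasFDerivAt {n : ℕ} (z : EuclideanSpace ℝ (Fin n)) (p : ℝ)
    (x : EuclideanSpace ℝ (Fin n)) :
    HasFDerivAt (wt z p) ((p * (1 + ‖x - z‖ ^ 2) ^ (p - 1)) •
      ((2 : ℝ) • (innerSL ℝ (x - z)))) x := by
  have h1 : HasFDerivAt (fun y : EuclideanSpace ℝ (Fin n) => 1 + ‖y - z‖ ^ 2)
      ((2 : ℝ) • (innerSL ℝ (x - z))) x := by
    have := (((hasFDerivAt_id (𝕜 := ℝ) x).sub_const z).norm_sq).const_add 1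
    refine this.congr_fderiv ?_
    ext v
    simp
  exact h1.rpow_const (Or.inl (base_pos z x).ne')

lemma wt_fderiv_single {n : ℕ} (z : EuclideanSpace ℝ (Fin n)) (p A b : ℝ)
    (x : EuclideanSpace ℝ (Fin n)) (i : Fin n) :
    fderiv ℝ (fun y => A + b * wt z p y) x (EuclideanSpace.single i 1)
      = (2 * b * p) * (wt z (p - 1) x * (x i - z i)) := by
  rw [(((wt_hasFDerivAt z p x).const_mul b).const_add A).fderiv]
  simp [wt, EuclideanSpace.inner_single_right]
  ring

lemma wt_grad {n : ℕ} (z : EuclideanSpace ℝ (Fin n)) (p A b : ℝ)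
    (x : EuclideanSpace ℝ (Fin n)) :
    spaceGrad (fun y => A + b * wt z p y) x
      = (2 * b * p * wt z (p - 1) x) • (x - z) := by
  unfold spaceGrad
  simp only [wt_fderiv_single]
  ext i
  simp
  ring

lemma wt_hess {n : ℕ} (z : EuclideanSpace ℝ (Fin n)) (p A b : ℝ)
    (x : EuclideanSpace ℝ (Fin n)) :
    spaceHess (fun y => A + b * wt z p y) x
      = (2 * b * p * wt z (p - 1) x) • (1 : Matrix (Fin n) (Fin n) ℝ)
        + (2 * b * p * (2 * (p - 1) * wt z (p - 2) x)) • outerProd (x - z) := by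
  unfold spaceHess
  simp only [wt_fderiv_single]
  ext i j
  have h1 : HasFDerivAt (fun y : EuclideanSpace ℝ (Fin n) => y j - z j)
      (EuclideanSpace.proj j : EuclideanSpace ℝ (Fin n) →L[ℝ] ℝ) x :=
    ((EuclideanSpace.proj j : EuclideanSpace ℝ (Fin n) →L[ℝ] ℝ).hasFDerivAt).sub_const (z j)
  have h2 := (((wt_hasFDerivAt z (p - 1) x).mul h1).const_mul (2 * b * p)).fderiv
  have h3 : p - 1 - 1 = p - 2 := by ring
  simp only [Matrix.of_apply]
  erw [h2]
  rw [h3]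
  by_cases hij : i = j
  · subst hij
    simp [wt, EuclideanSpace.inner_single_right, outerProd]
    ring
  · have hji : j ≠ i := fun h => hij h.symm
    simp [wt, EuclideanSpace.inner_single_right, outerProd, hij, hji]
    ring

lemma wt_pos {n : ℕ} (z : EuclideanSpace ℝ (Fin n)) (p : ℝ)
    (x : EuclideanSpace ℝ (Fin n)) : 0 < wt z p x :=
  Real.rpow_pos_of_pos (base_pos z x) p

/-- The bound on `H` coming from finiteness of `Λ^sup`. -/
lemma H_bound {n : ℕ} {H : EuclideanSpace ℝ (Fin n) → Matrix (Fin n) (Fin n) ℝ → ℝ} {k₁ C : ℝ}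
    (hH : ConditionsABC n H k₁)
    (hC : ∀ (lam : ℝ) (e : EuclideanSpace ℝ (Fin n)), ‖e‖ = 1 →
      H e (lam • outerProd e + 1) ≤ C) (a μ : ℝ) (ha : 0 < a)
    (y : EuclideanSpace ℝ (Fin n)) (hy : y ≠ 0) :
    H (a • y) (a • (1 : Matrix (Fin n) (Fin n) ℝ) + μ • outerProd y)
      ≤ (a * ‖y‖) ^ k₁ * (a * C) := by
  have hr : 0 < ‖y‖ := norm_pos_iff.mpr hy
  set e : EuclideanSpace ℝ (Fin n) := ‖y‖⁻¹ • y with he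
  have hen : ‖e‖ = 1 := by
    rw [he, norm_smul, norm_inv, norm_norm, inv_mul_cancel₀ hr.ne']
  have hye : y = ‖y‖ • e := by rw [he, smul_smul, mul_inv_cancel₀ hr.ne', one_smul]
  have hq : a • y = (a * ‖y‖) • e := by rw [mul_smul, ← hye]
  have hX : a • (1 : Matrix (Fin n) (Fin n) ℝ) + μ • outerProd y
      = a • ((μ * ‖y‖ ^ 2 / a) • outerProd e + 1) := by
    ext i j
    have hi : y i = ‖y‖ * e i := congrArg (fun v : EuclideanSpace ℝ (Fin n) => v i) hye
    have hj : y j = ‖y‖ * e j := congrArg (fun v : EuclideanSpace ℝ (Fin n) => v j) hye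
    simp only [Matrix.add_apply, Matrix.smul_apply, outerProd, Matrix.of_apply, smul_eq_mul]
    rw [hi, hj]
    field_simp
    ring
  rw [hX, hH.hom_X a ha, hq, hH.hom_q, abs_of_pos (mul_pos ha hr)]
  have := hC (μ * ‖y‖ ^ 2 / a) e hen
  have h0 : 0 ≤ (a * ‖y‖) ^ k₁ := by positivity
  calc a * ((a * ‖y‖) ^ k₁ * H e ((μ * ‖y‖ ^ 2 / a) • outerProd e + 1))
      = (a * ‖y‖) ^ k₁ * (a * H e ((μ * ‖y‖ ^ 2 / a) • outerProd e + 1)) := by ring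
    _ ≤ _ := by gcongr

/-- Scalar estimates: the size of the gradient of the barrier. -/
lemma scal_bound (b D p r k₁ σ : ℝ) (hk : 0 < k₁) (hσ : 1 < σ) (hσγ : (k₁ + 2) / 2 < σ)
    (hp : p = σ / (σ - 1) / 2) (hb : 0 < b) (hbD : 2 * b * p ≤ D) (hr : 0 ≤ r) :
    (2 * b * p * (1 + r ^ 2) ^ (p - 1) * r) ^ k₁ * (2 * b * p * (1 + r ^ 2) ^ (p - 1))
        ≤ D ^ k₁ * D * (1 + r ^ 2) ^ p ∧
    (2 * b * p * (1 + r ^ 2) ^ (p - 1) * r) ^ σ ≤ D ^ σ * (1 + r ^ 2) ^ p := by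
  have hσ1 : 0 < σ - 1 := by linarith
  have hp0 : 0 < p := by rw [hp]; positivity
  set s := 1 + r ^ 2 with hs
  have hs1 : 1 ≤ s := by nlinarith [sq_nonneg r]
  have hs0 : 0 < s := by linarith
  have hD : 0 < D := lt_of_lt_of_le (by positivity) hbD
  have hrs : r ≤ s ^ (1 / 2 : ℝ) := by
    rw [← Real.sqrt_eq_rpow]
    exact Real.le_sqrt_of_sq_le (by linarith)
  have h1 : 2 * b * p * s ^ (p - 1) * r ≤ D * s ^ (p - 1 / 2) := by
    have : s ^ (p - 1 / 2) = s ^ (p - 1) * s ^ (1 / 2 : ℝ) := by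
      rw [← Real.rpow_add hs0]; ring_nf
    rw [this, ← mul_assoc]
    gcongr
  have h2 : 2 * b * p * s ^ (p - 1) ≤ D * s ^ (p - 1) := by gcongr
  have h0 : 0 ≤ 2 * b * p * s ^ (p - 1) * r := by positivity
  have hpow : ∀ c : ℝ, 0 < c → (2 * b * p * s ^ (p - 1) * r) ^ c
      ≤ D ^ c * s ^ ((p - 1 / 2) * c) := by
    intro c hc
    calc _ ≤ (D * s ^ (p - 1 / 2)) ^ c := Real.rpow_le_rpow h0 h1 hc.le
      _ = _ := by rw [Real.mul_rpow hD.le (by positivity), ← Real.rpow_mul hs0.le]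
  constructor
  · calc _ ≤ (D ^ k₁ * s ^ ((p - 1 / 2) * k₁)) * (D * s ^ (p - 1)) := by
          have := hpow k₁ hk
          gcongr
      _ = D ^ k₁ * D * s ^ ((p - 1 / 2) * k₁ + (p - 1)) := by rw [Real.rpow_add hs0]; ring
      _ ≤ _ := by
          gcongr
          have : (p - 1 / 2) * k₁ ≤ 1 := by
            rw [hp]
            have : (σ / (σ - 1) / 2 - 1 / 2) = 1 / (2 * (σ - 1)) := by field_simp; ring
            rw [this, div_mul_eq_mul_div, div_le_one (by positivity)]
            linarith
          linarith
  · have h3 : (p - 1 / 2) * σ = p := by rw [hp]; field_simp; ring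
    have := hpow σ (by linarith)
    rwa [h3] at this

/-- **Theorem 2.6(b)** (maximum principle, `k > 1`, `σ > γ/2`).
Here `γ = k₁ + 2 > 2` and `σ* = σ/(σ-1)`. -/
theorem maximum_principle_k_gt_one_supercritical
    (n : ℕ) (hn : 2 ≤ n)
    (H : EuclideanSpace ℝ (Fin n) → Matrix (Fin n) (Fin n) ℝ → ℝ) (k₁ : ℝ)
    (hH : ConditionsABC n H k₁) (hk₁ : 0 < k₁)
    (hΛ : LambdaSupFinite n H)
    (T : ℝ) (hT : 0 < T)
    (h : EuclideanSpace ℝ (Fin n) → ℝ) (hhcont : Continuous h)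
    (hhbdd : BddAbove (Set.range h))
    (m : ℝ) (Z : ℝ → ℝ)
    (hZcont : ContinuousOn Z (Ici m)) (hZanti : AntitoneOn Z (Ici m))
    (hZnonneg : ∀ s ∈ Ici m, 0 ≤ Z s)
    (χ : ℝ → ℝ) (hχcont : ContinuousOn χ (Ioo 0 T))
    (hχbdd : BddAbove ((fun t => |χ t|) '' Ioo 0 T))
    (σ : ℝ) (hσγ : (k₁ + 2) / 2 < σ)
    (u : EuclideanSpace ℝ (Fin n) × ℝ → ℝ)
    (husc : UpperSemicontinuousOn u (univ ×ˢ Ico 0 T))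
    (hinf : ∃ c, m < c ∧ ∀ (x : EuclideanSpace ℝ (Fin n)), ∀ t ∈ Ico 0 T, c ≤ u (x, t))
    (hsub : ParabolicSubsolution
      (fun t r q X pt => H q (X + Z r • outerProd q) + χ t * ‖q‖ ^ σ - pt)
      (univ ×ˢ Ioo 0 T) u)
    (hinit : ∀ x, u (x, 0) ≤ h x)
    (z : EuclideanSpace ℝ (Fin n))
    (hgrow : ∀ ε > (0:ℝ), ∃ R₀ : ℝ, ∀ R ≥ R₀, ∀ (x : EuclideanSpace ℝ (Fin n)) (t : ℝ),
      ‖x - z‖ ≤ R → t ∈ Ioo 0 T → u (x, t) ≤ ε * R ^ (σ / (σ - 1))) :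
    ∀ (x : EuclideanSpace ℝ (Fin n)), ∀ t ∈ Ioo 0 T, u (x, t) ≤ ⨆ y, h y := by
  intro x₁ t₁ ht₁
  obtain ⟨C₀, hC₀⟩ := hΛ
  obtain ⟨K₀, hK₀⟩ := hχbdd
  set C := max C₀ 0 with hCdef
  set K := max K₀ 0 with hKdef
  have hC : ∀ (lam : ℝ) (e : EuclideanSpace ℝ (Fin n)), ‖e‖ = 1 →
      H e (lam • outerProd e + 1) ≤ C := fun l e he => (hC₀ l e he).trans (le_max_left _ _)
  have hCnn : 0 ≤ C := le_max_right _ _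
  have hKnn : 0 ≤ K := le_max_right _ _
  have hK : ∀ t ∈ Ioo 0 T, χ t ≤ K := fun t ht =>
    (le_abs_self _).trans ((hK₀ ⟨t, ht, rfl⟩).trans (le_max_left _ _))
  have hσ : 1 < σ := by linarith
  have hσ1 : 0 < σ - 1 := by linarith
  set β := σ / (σ - 1) with hβ
  have hβ0 : 0 < β := by positivity
  set p := β / 2 with hp
  have hp0 : 0 < p := by positivity
  set M := ⨆ y, h y with hM
  have hhM : ∀ y, h y ≤ M := fun y => le_ciSup hhbdd y
  set c := (1 + T) * β with hc
  have hc0 : 0 < c := by positivity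
  -- smallness of ε
  have hsmall : ∀ᶠ ε in 𝓝[>] (0 : ℝ), C * (c * ε) ^ k₁ * c + K * (c * ε) ^ (σ - 1) * c < 1 := by
    have hcont : ContinuousAt
        (fun ε : ℝ => C * (c * ε) ^ k₁ * c + K * (c * ε) ^ (σ - 1) * c) 0 := by
      have e1 : Continuous (fun ε : ℝ => (c * ε) ^ k₁) :=
        (continuous_const.mul continuous_id).rpow_const (fun _ => Or.inr hk₁.le)
      have e2 : Continuous (fun ε : ℝ => (c * ε) ^ (σ - 1)) :=
        (continuous_const.mul continuous_id).rpow_const (fun _ => Or.inr hσ1.le)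
      exact (((continuous_const.mul e1).mul continuous_const).add
        ((continuous_const.mul e2).mul continuous_const)).continuousAt
    have : ∀ᶠ ε in 𝓝 (0 : ℝ), C * (c * ε) ^ k₁ * c + K * (c * ε) ^ (σ - 1) * c < 1 := by
      refine hcont.eventually_lt_const ?_
      simp [Real.zero_rpow hk₁.ne', Real.zero_rpow hσ1.ne']
    exact this.filter_mono nhdsWithin_le_nhds
  have hlim : Tendsto (fun ε : ℝ => M + ε * ((1 + t₁) * wt z p x₁ + 1)) (𝓝[>] 0) (𝓝 M) := by
    have : Continuous (fun ε : ℝ => M + ε * ((1 + t₁) * wt z p x₁ + 1)) := by fun_prop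
    have h2 := this.tendsto 0
    simp only [zero_mul, add_zero] at h2
    exact h2.mono_left nhdsWithin_le_nhds
  refine ge_of_tendsto hlim ?_
  filter_upwards [hsmall, self_mem_nhdsWithin] with ε hε1 hε0
  have hε : (0 : ℝ) < ε := hε0
  -- choose the radius
  obtain ⟨R₀, hR₀⟩ := hgrow (ε / 2) (by positivity)
  obtain ⟨R, hRM, hRR₀, hRx, hR1⟩ : ∃ R : ℝ, 2 * |M| / ε ≤ R ^ β ∧ R₀ ≤ R ∧ ‖x₁ - z‖ < R ∧
      1 ≤ R := by
    have := ((tendsto_rpow_atTop hβ0).eventually_ge_atTop (2 * |M| / ε)).and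
      ((eventually_ge_atTop R₀).and ((eventually_gt_atTop ‖x₁ - z‖).and (eventually_ge_atTop 1)))
    exact this.exists
  set Tm := (t₁ + T) / 2 with hTm
  have hTmt : t₁ < Tm := by rw [hTm]; linarith [ht₁.2]
  have hTmT : Tm < T := by rw [hTm]; linarith [ht₁.2]
  have hTm0 : 0 < Tm := ht₁.1.trans hTmt
  set A := ε / 2 * R ^ β with hA
  obtain ⟨N, hN0, hN⟩ : ∃ N : ℝ, 0 ≤ N ∧ A - M ≤ ε * Real.exp (N * (Tm - t₁)) := by
    refine ⟨|A - M| / ε / (Tm - t₁), by have := sub_pos.2 hTmt; positivity, ?_⟩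
    have hne : Tm - t₁ ≠ 0 := (sub_pos.2 hTmt).ne'
    rw [div_mul_cancel₀ _ hne]
    have := Real.add_one_le_exp (|A - M| / ε)
    calc A - M ≤ |A - M| := le_abs_self _
      _ = ε * (|A - M| / ε) := by field_simp
      _ ≤ _ := by gcongr; linarith
  let φ : EuclideanSpace ℝ (Fin n) → ℝ → ℝ := fun x t =>
    (M + ε * Real.exp (N * (t - t₁))) + (ε * (1 + t)) * wt z p x
  have hwt_ge : ∀ x, ‖x - z‖ ^ β ≤ wt z p x := by
    intro x
    have : ‖x - z‖ ^ β = (‖x - z‖ ^ 2) ^ p := by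
      rw [← Real.rpow_natCast, ← Real.rpow_mul (norm_nonneg _)]
      congr 1
      rw [hp]; push_cast; ring
    rw [this]
    exact Real.rpow_le_rpow (by positivity) (by linarith) hp0.le
  by_contra hcon
  push Not at hcon
  have hφ₁ : 0 < u (x₁, t₁) - φ x₁ t₁ := by
    simp only [φ, sub_self, mul_zero, Real.exp_zero]
    linarith
  -- outside the ball
  have hout : ∀ x t, R ≤ ‖x - z‖ → t ∈ Ioo 0 T → u (x, t) - φ x t ≤ 0 := by
    intro x t hx ht
    have h1 := hR₀ ‖x - z‖ (hRR₀.trans hx) x t le_rfl ht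
    have h2 : R ^ β ≤ ‖x - z‖ ^ β := Real.rpow_le_rpow (by linarith) hx hβ0.le
    have h3 : |M| ≤ ε / 2 * ‖x - z‖ ^ β := by
      have := hRM.trans h2
      rw [div_le_iff₀ hε] at this
      linarith
    have h4 : ε * ‖x - z‖ ^ β ≤ ε * (1 + t) * wt z p x := by
      have := hwt_ge x
      have h5 := wt_pos z p x
      have := ht.1
      calc ε * ‖x - z‖ ^ β ≤ ε * wt z p x := by gcongr
        _ ≤ _ := by nlinarith [mul_pos (mul_pos hε this) h5]
    have h5 : 0 < ε * Real.exp (N * (t - t₁)) := by positivity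
    have h6 := neg_abs_le M
    simp only [φ]
    linarith
  have hcontφ : Continuous (fun q : EuclideanSpace ℝ (Fin n) × ℝ => φ q.1 q.2) := by
    have := (wt_contDiff z p).continuous
    simp only [φ]
    fun_prop
  let S : Set (EuclideanSpace ℝ (Fin n) × ℝ) := Metric.closedBall z R ×ˢ Icc 0 Tm
  have hScomp : IsCompact S := (isCompact_closedBall z R).prod isCompact_Icc
  have hSsub : S ⊆ univ ×ˢ Ico 0 T := fun q hq =>
    ⟨mem_univ _, hq.2.1, hq.2.2.trans_lt hTmT⟩
  have hx₁S : (x₁, t₁) ∈ S := by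
    refine ⟨?_, ht₁.1.le, hTmt.le⟩
    simp only [Metric.mem_closedBall, dist_eq_norm]
    exact hRx.le
  have huscS : UpperSemicontinuousOn
      (fun q : EuclideanSpace ℝ (Fin n) × ℝ => u q + (- φ q.1 q.2)) S :=
    (husc.mono hSsub).add hcontφ.neg.continuousOn.upperSemicontinuousOn
  obtain ⟨⟨x₀, t₀⟩, hp₀S, hp₀⟩ := huscS.exists_isMaxOn ⟨_, hx₁S⟩ hScomp
  have hpos : 0 < u (x₀, t₀) - φ x₀ t₀ := by
    have := hp₀ hx₁S
    simp only [mem_ofPred_eq] at this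
    linarith
  have ht₀0 : 0 < t₀ := by
    rcases hp₀S.2.1.lt_or_eq with h1 | h1
    · exact h1
    exfalso
    simp only at h1
    rw [← h1] at hpos
    have e1 := hinit x₀
    have e2 := hhM x₀
    have e3 : 0 < ε * Real.exp (N * (0 - t₁)) := by positivity
    have e4 : 0 < ε * (1 + 0) * wt z p x₀ := by have := wt_pos z p x₀; positivity
    simp only [φ] at hpos
    linarith
  have ht₀T : t₀ ∈ Ioo 0 T := ⟨ht₀0, hp₀S.2.2.trans_lt hTmT⟩
  have hx₀R : ‖x₀ - z‖ < R := by
    by_contra hge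
    push Not at hge
    linarith [hout x₀ t₀ hge ht₀T]
  have ht₀Tm : t₀ < Tm := by
    rcases hp₀S.2.2.lt_or_eq with h1 | h1
    · exact h1
    exfalso
    simp only at h1
    have e1 : u (x₀, t₀) ≤ A := hR₀ R hRR₀ x₀ t₀ hx₀R.le ht₀T
    have e4 : 0 < ε * (1 + t₀) * wt z p x₀ := by have := wt_pos z p x₀; positivity
    rw [← h1] at hN
    simp only [φ] at hpos
    linarith
  have hloc : IsLocalMaxOn (fun q : EuclideanSpace ℝ (Fin n) × ℝ => u q - φ q.1 q.2)
      (univ ×ˢ Ioo 0 T) (x₀, t₀) := by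
    have hnh : S ∈ 𝓝 (x₀, t₀) := by
      refine prod_mem_nhds ?_ (Icc_mem_nhds ht₀0 ht₀Tm)
      refine Filter.mem_of_superset (Metric.isOpen_ball.mem_nhds (x := x₀) (s := Metric.ball z R) ?_)
        Metric.ball_subset_closedBall
      simpa [dist_eq_norm] using hx₀R
    refine Filter.Eventually.filter_mono nhdsWithin_le_nhds ?_
    filter_upwards [hnh] with q hq
    have := hp₀ hq
    simp only [mem_ofPred_eq] at this
    linarith
  have hmain := hsub φ ?_ ?_ x₀ t₀ ⟨mem_univ _, ht₀T⟩ hloc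
  rotate_left
  · intro t
    simp only [φ]
    exact contDiff_const.add (contDiff_const.mul (wt_contDiff z p))
  · intro x
    simp only [φ]
    fun_prop
  have hderiv : deriv (φ x₀) t₀ = ε * (Real.exp (N * (t₀ - t₁)) * N) + ε * wt z p x₀ := by
    have d1 : HasDerivAt (fun t : ℝ => N * (t - t₁)) N t₀ := by
      simpa using ((hasDerivAt_id t₀).sub_const t₁).const_mul N
    have d2 : HasDerivAt (fun t : ℝ => ε * (1 + t)) ε t₀ := by
      simpa using ((hasDerivAt_id t₀).const_add 1).const_mul ε
    exact (((d1.exp.const_mul ε).const_add M).add (d2.mul_const (wt z p x₀))).deriv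
  have hw0 := wt_pos z p x₀
  have hdge : ε * wt z p x₀ ≤ deriv (φ x₀) t₀ := by
    rw [hderiv]
    have : 0 ≤ ε * (Real.exp (N * (t₀ - t₁)) * N) := by positivity
    linarith
  set b := ε * (1 + t₀) with hb
  have hb0 : 0 < b := by positivity
  have hgrad : spaceGrad (fun x => φ x t₀) x₀ = (2 * b * p * wt z (p - 1) x₀) • (x₀ - z) :=
    wt_grad z p _ b x₀
  have hhess : spaceHess (fun x => φ x t₀) x₀
      = (2 * b * p * wt z (p - 1) x₀) • (1 : Matrix (Fin n) (Fin n) ℝ)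
        + (2 * b * p * (2 * (p - 1) * wt z (p - 2) x₀)) • outerProd (x₀ - z) :=
    wt_hess z p _ b x₀
  simp only [hgrad, hhess] at hmain
  set a := 2 * b * p * wt z (p - 1) x₀ with ha
  have ha0 : 0 < a := by have := wt_pos z (p - 1) x₀; positivity
  have hepos : 0 < ε * wt z p x₀ := by positivity
  by_cases hy : x₀ - z = 0
  · have hq0 : ∀ X, H (a • (x₀ - z)) X = 0 := by
      intro X
      have := hH.hom_q 0 (a • (x₀ - z)) X
      rw [hy] at this ⊢
      simpa [Real.zero_rpow hk₁.ne'] using this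
    rw [hq0, hy] at hmain
    simp only [smul_zero, norm_zero, Real.zero_rpow (by linarith : σ ≠ 0), mul_zero] at hmain
    linarith
  · have hXeq : a • (1 : Matrix (Fin n) (Fin n) ℝ)
        + (2 * b * p * (2 * (p - 1) * wt z (p - 2) x₀)) • outerProd (x₀ - z)
        + Z (u (x₀, t₀)) • outerProd (a • (x₀ - z))
        = a • (1 : Matrix (Fin n) (Fin n) ℝ)
        + (2 * b * p * (2 * (p - 1) * wt z (p - 2) x₀) + Z (u (x₀, t₀)) * a ^ 2) •
          outerProd (x₀ - z) := by
      ext i j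
      simp [outerProd]
      ring
    rw [hXeq, norm_smul, Real.norm_of_nonneg ha0.le] at hmain
    have hHb := H_bound hH hC a
      (2 * b * p * (2 * (p - 1) * wt z (p - 2) x₀) + Z (u (x₀, t₀)) * a ^ 2) ha0 (x₀ - z) hy
    have hbD : 2 * b * p ≤ c * ε := by
      rw [hb, hp, hc]
      have := ht₀T.2
      calc 2 * (ε * (1 + t₀)) * (β / 2) = (1 + t₀) * β * ε := by ring
        _ ≤ _ := by gcongr
    obtain ⟨s1, s2⟩ := scal_bound b (c * ε) p ‖x₀ - z‖ k₁ σ hk₁ hσ hσγ hp hb0 hbD (norm_nonneg _)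
    change (a * ‖x₀ - z‖) ^ k₁ * a ≤ (c * ε) ^ k₁ * (c * ε) * wt z p x₀ at s1
    change (a * ‖x₀ - z‖) ^ σ ≤ (c * ε) ^ σ * wt z p x₀ at s2
    have hcε : 0 < c * ε := by positivity
    have f1 : (a * ‖x₀ - z‖) ^ k₁ * (a * C) ≤ C * ((c * ε) ^ k₁ * (c * ε) * wt z p x₀) := by
      calc _ = C * ((a * ‖x₀ - z‖) ^ k₁ * a) := by ring
        _ ≤ _ := by gcongr
    have f2 : χ t₀ * (a * ‖x₀ - z‖) ^ σ ≤ K * ((c * ε) ^ σ * wt z p x₀) := by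
      have g1 : 0 ≤ (a * ‖x₀ - z‖) ^ σ := by positivity
      calc _ ≤ K * (a * ‖x₀ - z‖) ^ σ := mul_le_mul_of_nonneg_right (hK t₀ ht₀T) g1
        _ ≤ _ := by gcongr
    have f3 : (c * ε) ^ σ = (c * ε) ^ (σ - 1) * (c * ε) := by
      rw [Real.rpow_sub_one hcε.ne', div_mul_cancel₀ _ hcε.ne']
    rw [f3] at f2
    have f4 := mul_lt_mul_of_pos_right hε1 hepos
    have f5 : (C * (c * ε) ^ k₁ * c + K * (c * ε) ^ (σ - 1) * c) * (ε * wt z p x₀)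
        = C * ((c * ε) ^ k₁ * (c * ε) * wt z p x₀)
          + K * ((c * ε) ^ (σ - 1) * (c * ε) * wt z p x₀) := by ring
    rw [f5, one_mul] at f4
    exact absurd hmain (not_le.mpr (by linarith only [hHb, f1, f2, f4, hdge]))
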